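/- arXiv:2508.13611 — 2 statements merged into one kernel-verified Lean document; each statement's English description precedes it below -/
import Mathlib

section
/- Let T = (St, →) be an LTS over an action set A equipped with a binary join operation & : St × St → St satisfying: for all s, t, w and a ∈ A, (s&t) →a w iff there exist s', t' with w = s'&t', s →a s', and t →a t'. Suppose T contains a universal state u, i.e. for every a ∈ A there exists u' with u →a u' and u' ∼ u. Taking T both as process LTS and environment LTS, for all states e, f of T: e ≤ f (e can be simulated by f) if and only if ji-parameterized simulation equivalence with respect to f is included in ji-parameterized simulation equivalence with respect to e, i.e. for all p, q ∈ St, if (p&f) ≤ (q&f) and (q&f) ≤ (p&f), then (p&e) ≤ (q&e) and (q&e) ≤ (p&e). -/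
/-- A simulation from the LTS `tr1` to the LTS `tr2` (over the same action set). -/
def IsSim {A St1 St2 : Type*} (tr1 : St1 → A → St1 → Prop)
    (tr2 : St2 → A → St2 → Prop) (S : St1 → St2 → Prop) : Prop :=
  ∀ s t, S s t → ∀ a s', tr1 s a s' → ∃ t', tr2 t a t' ∧ S s' t'

/-- `s` can be simulated by `t`. -/
def SimBy {A St1 St2 : Type*} (tr1 : St1 → A → St1 → Prop)
    (tr2 : St2 → A → St2 → Prop) (s : St1) (t : St2) : Prop :=
  ∃ S, IsSim tr1 tr2 S ∧ S s t

/-- A bisimulation on the LTS `tr`: both `B` and its converse are simulations. -/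
def IsBisim {A St : Type*} (tr : St → A → St → Prop) (B : St → St → Prop) : Prop :=
  IsSim tr tr B ∧ IsSim tr tr (fun t s => B s t)

/-- `s` and `t` are bisimilar. -/
def Bisim {A St : Type*} (tr : St → A → St → Prop) (s t : St) : Prop :=
  ∃ B, IsBisim tr B ∧ B s t

/-- The join-interaction LTS `T1 & T2`: simultaneous equally-labeled transitions. -/
def joinTr {A St1 St2 : Type*} (tr1 : St1 → A → St1 → Prop)
    (tr2 : St2 → A → St2 → Prop) : St1 × St2 → A → St1 × St2 → Prop :=
  fun s a s' => tr1 s.1 a s'.1 ∧ tr2 s.2 a s'.2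

/-- The right-determinizing join LTS `P ⊕ E`: actions are pairs `(a, e')`
    recording the target of the environment transition. -/
def dotTr {A Pr Env : Type*} (tr : Pr → A → Pr → Prop)
    (trE : Env → A → Env → Prop) : Pr × Env → A × Env → Pr × Env → Prop :=
  fun s l s' => tr s.1 l.1 s'.1 ∧ trE s.2 l.1 s'.2 ∧ s'.2 = l.2

/-- An `E`-parameterized simulation on the process LTS `tr`. -/
def IsParamSim {A Pr Env : Type*} (tr : Pr → A → Pr → Prop)
    (trE : Env → A → Env → Prop) (S : Env → Pr → Pr → Prop) : Prop :=
  ∀ e p q, S e p q → ∀ a e', trE e a e' → ∀ p', tr p a p' →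
    ∃ q', tr q a q' ∧ S e' p' q'

/-- `p ⊑_e q`: `p` can be simulated by `q` with respect to environment `e`. -/
def ParamSimBy {A Pr Env : Type*} (tr : Pr → A → Pr → Prop)
    (trE : Env → A → Env → Prop) (e : Env) (p q : Pr) : Prop :=
  ∃ S, IsParamSim tr trE S ∧ S e p q

/-- An `E`-parameterized bisimulation on the process LTS `tr`. -/
def IsParamBisim {A Pr Env : Type*} (tr : Pr → A → Pr → Prop)
    (trE : Env → A → Env → Prop) (B : Env → Pr → Pr → Prop) : Prop :=
  ∀ e p q, B e p q → ∀ a e', trE e a e' →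
    ((∀ p', tr p a p' → ∃ q', tr q a q' ∧ B e' p' q') ∧
     (∀ q', tr q a q' → ∃ p', tr p a p' ∧ B e' p' q'))

/-- `p ∼_e q`: `p` and `q` are bisimilar with respect to environment `e`. -/
def ParamBisim {A Pr Env : Type*} (tr : Pr → A → Pr → Prop)
    (trE : Env → A → Env → Prop) (e : Env) (p q : Pr) : Prop :=
  ∃ B, IsParamBisim tr trE B ∧ B e p q

/-- Reachability via a path of transitions. -/
def Reachable {A St : Type*} (tr : St → A → St → Prop) : St → St → Prop :=
  Relation.ReflTransGen (fun s t => ∃ a, tr s a t)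

/-- A state is deterministic if every reachable state has at most one
    `a`-derivative, for each action `a`. -/
def Deterministic {A St : Type*} (tr : St → A → St → Prop) (s : St) : Prop :=
  ∀ t, Reachable tr s t → ∀ (a : A) (t1 t2 : St), tr t a t1 → tr t a t2 → t1 = t2

/-- A state is image-finite if every reachable state has only finitely many
    `a`-derivatives, for each action `a`. -/
def ImageFinite {A St : Type*} (tr : St → A → St → Prop) (s : St) : Prop :=
  ∀ t, Reachable tr s t → ∀ a : A, {t' | tr t a t'}.Finite

/-- Positive modal formulas: `⊤`, conjunction, diamond modalities. -/
inductive PosForm (A : Type*) where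
  | top : PosForm A
  | and : PosForm A → PosForm A → PosForm A
  | dia : A → PosForm A → PosForm A

/-- Satisfaction of positive formulas. -/
def psat {A St : Type*} (tr : St → A → St → Prop) : PosForm A → St → Prop
  | .top, _ => True
  | .and φ ψ, s => psat tr φ s ∧ psat tr ψ s
  | .dia a φ, s => ∃ s', tr s a s' ∧ psat tr φ s'

/-- The set of positive formulas satisfied by a state. -/
def posSat {A St : Type*} (tr : St → A → St → Prop) (s : St) : Set (PosForm A) :=
  {φ | psat tr φ s}

/-- Simple modal formulas: `⊤`, negation, conjunction, diamond modalities. -/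
inductive Form (A : Type*) where
  | top : Form A
  | neg : Form A → Form A
  | and : Form A → Form A → Form A
  | dia : A → Form A → Form A

/-- Satisfaction of modal formulas. -/
def msat {A St : Type*} (tr : St → A → St → Prop) : Form A → St → Prop
  | .top, _ => True
  | .neg φ, s => ¬ msat tr φ s
  | .and φ ψ, s => msat tr φ s ∧ msat tr ψ s
  | .dia a φ, s => ∃ s', tr s a s' ∧ msat tr φ s'

/-- The set of modal formulas satisfied by a state. -/
def modalSat {A St : Type*} (tr : St → A → St → Prop) (s : St) : Set (Form A) :=
  {φ | msat tr φ s}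

/-- The positive-formula projection, erasing negations. -/
def posProj {A : Type*} : Form A → PosForm A
  | .top => .top
  | .neg φ => posProj φ
  | .and φ ψ => .and (posProj φ) (posProj ψ)
  | .dia a φ => .dia a (posProj φ)

/-- Negation closure of a set of positive formulas. -/
def negClosure {A : Type*} (Φ : Set (PosForm A)) : Set (Form A) :=
  {ψ | posProj ψ ∈ Φ}

section Simulation

variable {A St : Type*} {tr : St → A → St → Prop}

theorem SimBy.refl (s : St) : SimBy tr tr s s :=
  ⟨Eq, by rintro s _ rfl a s' h; exact ⟨s', h, rfl⟩, rfl⟩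

theorem SimBy.trans {r s t : St} (hrs : SimBy tr tr r s) (hst : SimBy tr tr s t) :
    SimBy tr tr r t := by
  obtain ⟨R, hR, hr⟩ := hrs
  obtain ⟨S, hS, hs⟩ := hst
  refine ⟨fun x z => ∃ y, R x y ∧ S y z, ?_, s, hr, hs⟩
  rintro x z ⟨y, hxy, hyz⟩ a x' hx
  obtain ⟨y', hy, hxy'⟩ := hR x y hxy a x' hx
  obtain ⟨z', hz, hyz'⟩ := hS y z hyz a y' hy
  exact ⟨z', hz, y', hxy', hyz'⟩

theorem Bisim.simBy_symm {s t : St} (h : Bisim tr s t) : SimBy tr tr t s := by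
  obtain ⟨B, hB, hst⟩ := h
  exact ⟨_, hB.2, hst⟩

theorem simBy_universal {u : St} (hu : ∀ a : A, ∃ u', tr u a u' ∧ Bisim tr u' u) (s : St) :
    SimBy tr tr s u := by
  refine ⟨fun _ t => SimBy tr tr u t, ?_, .refl u⟩
  rintro s t ⟨S, hS, hut⟩ a s' -
  obtain ⟨u', huu', hbis⟩ := hu a
  obtain ⟨t', ht, hut'⟩ := hS u t hut a u' huu'
  exact ⟨t', ht, hbis.simBy_symm.trans ⟨S, hS, hut'⟩⟩

variable {join : St → St → St}

theorem join_simBy_left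
    (hjoin : ∀ (s t : St) (a : A) (w : St),
      tr (join s t) a w ↔ ∃ s' t', w = join s' t' ∧ tr s a s' ∧ tr t a t') (s t : St) :
    SimBy tr tr (join s t) s := by
  refine ⟨fun r s => ∃ t, r = join s t, ?_, t, rfl⟩
  rintro _ s ⟨t, rfl⟩ a w hw
  obtain ⟨s', t', rfl, hs, -⟩ := (hjoin s t a w).1 hw
  exact ⟨s', hs, t', rfl⟩

theorem join_simBy_right
    (hjoin : ∀ (s t : St) (a : A) (w : St),
      tr (join s t) a w ↔ ∃ s' t', w = join s' t' ∧ tr s a s' ∧ tr t a t') (s t : St) :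
    SimBy tr tr (join s t) t := by
  refine ⟨fun r t => ∃ s, r = join s t, ?_, s, rfl⟩
  rintro _ t ⟨s, rfl⟩ a w hw
  obtain ⟨s', t', rfl, -, ht⟩ := (hjoin s t a w).1 hw
  exact ⟨t', ht, s', rfl⟩

theorem simBy_join
    (hjoin : ∀ (s t : St) (a : A) (w : St),
      tr (join s t) a w ↔ ∃ s' t', w = join s' t' ∧ tr s a s' ∧ tr t a t') {r s t : St}
    (hs : SimBy tr tr r s) (ht : SimBy tr tr r t) : SimBy tr tr r (join s t) := by
  refine ⟨fun r w => ∃ s t, w = join s t ∧ SimBy tr tr r s ∧ SimBy tr tr r t, ?_,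
    s, t, rfl, hs, ht⟩
  rintro r _ ⟨s, t, rfl, ⟨S, hS, hrs⟩, ⟨T, hT, hrt⟩⟩ a r' hr
  obtain ⟨s', hs, hrs'⟩ := hS r s hrs a r' hr
  obtain ⟨t', ht, hrt'⟩ := hT r t hrt a r' hr
  exact ⟨join s' t', (hjoin s t a _).2 ⟨s', t', rfl, hs, ht⟩,
    s', t', rfl, ⟨S, hS, hrs'⟩, ⟨T, hT, hrt'⟩⟩

end Simulation

theorem stmt14 {A St : Type*} (tr : St → A → St → Prop)
    (join : St → St → St)
    (hjoin : ∀ (s t : St) (a : A) (w : St),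
      tr (join s t) a w ↔ ∃ s' t', w = join s' t' ∧ tr s a s' ∧ tr t a t')
    (u : St) (hu : ∀ a : A, ∃ u', tr u a u' ∧ Bisim tr u' u)
    (e f : St) :
    SimBy tr tr e f ↔
      ∀ p q : St,
        (SimBy tr tr (join p f) (join q f) ∧ SimBy tr tr (join q f) (join p f)) →
        (SimBy tr tr (join p e) (join q e) ∧ SimBy tr tr (join q e) (join p e)) := by
  constructor
  · intro hef p q ⟨hpq, hqp⟩
    have key : ∀ x y, SimBy tr tr (join x f) (join y f) →
        SimBy tr tr (join x e) (join y e) := fun x y h =>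
      simBy_join hjoin
        (((simBy_join hjoin (join_simBy_left hjoin x e)
          ((join_simBy_right hjoin x e).trans hef)).trans h).trans (join_simBy_left hjoin y f))
        (join_simBy_right hjoin x e)
    exact ⟨key p q hpq, key q p hqp⟩
  · intro h
    have hue := (h u f
      ⟨simBy_join hjoin (join_simBy_right hjoin u f) (join_simBy_right hjoin u f),
        simBy_join hjoin (simBy_universal hu _) (join_simBy_right hjoin f f)⟩).1
    exact ((simBy_join hjoin (simBy_universal hu e) (.refl e)).trans hue).trans
      (join_simBy_left hjoin f e)
end

section
/- Let P be a process LTS and E an environment LTS over the same action set A. For all image-finite processes p, q of P and every image-finite environment e of E: p ji⊑_e q (equivalently, p ⊑_e q) if and only if L(p) ∩ L(e) ⊆ L(q) ∩ L(e), where L(p), L(q) are the sets of positive formulas satisfied by p, q in P and L(e) is the set of positive formulas satisfied by e in E. Moreover the implication from p ji⊑_e q to the inclusion of formula sets holds for all (not necessarily image-finite) p, q, e. -/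
section PositiveModalLogic

variable {A St1 St2 Pr Env : Type*}

theorem IsSim.psat_mono {tr1 : St1 → A → St1 → Prop} {tr2 : St2 → A → St2 → Prop}
    {S : St1 → St2 → Prop} (hS : IsSim tr1 tr2 S) (φ : PosForm A) {s : St1} {t : St2}
    (hst : S s t) (hs : psat tr1 φ s) : psat tr2 φ t := by
  induction φ generalizing s t with
  | top => trivial
  | and φ ψ ihφ ihψ => exact ⟨ihφ hst hs.1, ihψ hst hs.2⟩
  | dia a φ ih =>
    obtain ⟨s', hs', hφ⟩ := hs
    obtain ⟨t', ht', hst'⟩ := hS s t hst a s' hs'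
    exact ⟨t', ht', ih hst' hφ⟩

theorem SimBy.posSat_subset {tr1 : St1 → A → St1 → Prop} {tr2 : St2 → A → St2 → Prop}
    {s : St1} {t : St2} (h : SimBy tr1 tr2 s t) : posSat tr1 s ⊆ posSat tr2 t := by
  obtain ⟨S, hS, hst⟩ := h
  exact fun φ => hS.psat_mono φ hst

theorem posSat_joinTr (tr : Pr → A → Pr → Prop) (trE : Env → A → Env → Prop)
    (p : Pr) (e : Env) : posSat (joinTr tr trE) (p, e) = posSat tr p ∩ posSat trE e := by
  ext φ
  change psat _ φ (p, e) ↔ psat tr φ p ∧ psat trE φ e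
  induction φ generalizing p e with
  | top => simp [psat]
  | and φ ψ ihφ ihψ => simp only [psat, ihφ, ihψ]; tauto
  | dia a φ ih =>
    simp only [psat, Prod.exists, ih, joinTr]
    grind

/-- A formula separating `s` from every state of a finite set, given one for each such state. -/
theorem exists_psat_forall_not_psat {tr1 : St1 → A → St1 → Prop} {tr2 : St2 → A → St2 → Prop}
    {s : St1} {F : Set St2} (hF : F.Finite) (h : ∀ t ∈ F, ¬ posSat tr1 s ⊆ posSat tr2 t) :
    ∃ φ, psat tr1 φ s ∧ ∀ t ∈ F, ¬ psat tr2 φ t := by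
  induction F, hF using Set.Finite.induction_on with
  | empty => exact ⟨.top, trivial, by simp⟩
  | @insert t F _ _ ih =>
    obtain ⟨φ, hφ, hφF⟩ := ih fun u hu => h u (Set.mem_insert_of_mem t hu)
    obtain ⟨ψ, hψ, hψt⟩ := Set.not_subset.mp (h t (Set.mem_insert t F))
    refine ⟨.and ψ φ, ⟨hψ, hφ⟩, ?_⟩
    rintro u (rfl | hu) hsat
    · exact hψt hsat.1
    · exact hφF u hu hsat.2

theorem ImageFinite.of_tr {tr : St1 → A → St1 → Prop} {s s' : St1} {a : A}
    (h : ImageFinite tr s) (hs : tr s a s') : ImageFinite tr s' :=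
  fun t ht => h t (ht.head ⟨a, hs⟩)

/-- Only the simulating state needs to be image-finite. -/
theorem SimBy.of_posSat_subset {tr1 : St1 → A → St1 → Prop} {tr2 : St2 → A → St2 → Prop}
    {s : St1} {t : St2} (ht : ImageFinite tr2 t) (h : posSat tr1 s ⊆ posSat tr2 t) :
    SimBy tr1 tr2 s t := by
  refine ⟨fun s t => ImageFinite tr2 t ∧ posSat tr1 s ⊆ posSat tr2 t, ?_, ht, h⟩
  rintro s t ⟨ht, h⟩ a s' hs'
  by_contra! hne
  obtain ⟨φ, hφ, hφF⟩ := exists_psat_forall_not_psat (tr1 := tr1) (ht t .refl a)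
    fun t' ht' => hne t' ht' (ht.of_tr ht')
  obtain ⟨t', ht', hsat⟩ : psat tr2 (.dia a φ) t :=
    @h (.dia a φ) ⟨s', hs', hφ⟩
  exact hφF t' ht' hsat

theorem paramSimBy_iff_simBy_joinTr_left {tr : Pr → A → Pr → Prop}
    {trE : Env → A → Env → Prop} {p q : Pr} {e : Env} :
    ParamSimBy tr trE e p q ↔ SimBy (joinTr tr trE) tr (p, e) q := by
  constructor
  · rintro ⟨S, hS, h⟩
    exact ⟨fun x q => S x.2 x.1 q,
      fun x q hx a x' hx' => hS x.2 x.1 q hx a x'.2 hx'.2 x'.1 hx'.1, h⟩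
  · rintro ⟨S, hS, h⟩
    exact ⟨fun e p q => S (p, e) q,
      fun e p q hpq a e' he' p' hp' => hS (p, e) q hpq a (p', e') ⟨hp', he'⟩, h⟩

theorem simBy_joinTr_iff_paramSimBy {tr : Pr → A → Pr → Prop}
    {trE : Env → A → Env → Prop} {p q : Pr} {e : Env} :
    SimBy (joinTr tr trE) (joinTr tr trE) (p, e) (q, e) ↔ ParamSimBy tr trE e p q := by
  constructor
  · rintro ⟨S, hS, h⟩
    refine paramSimBy_iff_simBy_joinTr_left.mpr ⟨fun x q => ∃ e, S x (q, e), ?_, e, h⟩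
    rintro x q ⟨e, hx⟩ a x' hx'
    obtain ⟨y', hy', hxy'⟩ := hS x (q, e) hx a x' hx'
    exact ⟨y'.1, hy'.1, y'.2, hxy'⟩
  · rintro ⟨S, hS, h⟩
    refine ⟨fun x y => x.2 = y.2 ∧ S x.2 x.1 y.1, ?_, rfl, h⟩
    rintro ⟨p, e⟩ ⟨q, _⟩ ⟨rfl, hpq⟩ a ⟨p', e'⟩ ⟨hp', he'⟩
    obtain ⟨q', hq', hpq'⟩ := hS e p q hpq a e' he' p' hp'
    exact ⟨(q', e'), ⟨hq', he'⟩, rfl, hpq'⟩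

end PositiveModalLogic

theorem stmt16 {A Pr Env : Type*} (tr : Pr → A → Pr → Prop)
    (trE : Env → A → Env → Prop) :
    (∀ (p q : Pr) (e : Env),
        SimBy (joinTr tr trE) (joinTr tr trE) (p, e) (q, e) ↔
          ParamSimBy tr trE e p q) ∧
    (∀ (p q : Pr) (e : Env),
        SimBy (joinTr tr trE) (joinTr tr trE) (p, e) (q, e) →
          posSat tr p ∩ posSat trE e ⊆ posSat tr q ∩ posSat trE e) ∧
    (∀ (p q : Pr) (e : Env),
        ImageFinite tr p → ImageFinite tr q → ImageFinite trE e →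
        (SimBy (joinTr tr trE) (joinTr tr trE) (p, e) (q, e) ↔
          posSat tr p ∩ posSat trE e ⊆ posSat tr q ∩ posSat trE e)) := by
  have posSat_subset (p q : Pr) (e : Env)
      (h : SimBy (joinTr tr trE) (joinTr tr trE) (p, e) (q, e)) :
      posSat tr p ∩ posSat trE e ⊆ posSat tr q ∩ posSat trE e := by
    simpa only [posSat_joinTr] using h.posSat_subset
  refine ⟨fun p q e => simBy_joinTr_iff_paramSimBy, posSat_subset,
    fun p q e _ hq _ => ⟨posSat_subset p q e, fun h => ?_⟩⟩
  rw [simBy_joinTr_iff_paramSimBy, paramSimBy_iff_simBy_joinTr_left]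
  refine SimBy.of_posSat_subset hq ?_
  rw [posSat_joinTr]
  exact h.trans Set.inter_subset_left
end
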